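/- Assume the time-reversal symmetric case (T_0 real, all h_j real). Suppose α° is a critical point of λ, λ(α°) is a simple eigenvalue of T(α°), and its unit eigenvector f° is non-vanishing on crossing edges. Then the N×N matrix Q(T(α°) − λ(α°)I − BΩ⁺B*)Q* has real entries, where Q is the orthogonal projection onto 𝒬 = Null(BPB*) and P is the orthogonal projection onto Null(Ω); in other words, the operator S is real. -/

import Mathlib

noncomputable section

open Matrix Complex
open scoped ComplexOrder

/-- Eigenvalues of a square complex matrix, sorted in increasing order
(junk value `0` if the matrix is not Hermitian). -/
noncomputable def sortedEigs {n : ℕ} (A : Matrix (Fin n) (Fin n) ℂ) : Fin n → ℝ :=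
  if hA : A.IsHermitian then hA.eigenvalues ∘ Tuple.sort hA.eigenvalues else 0

/-- The Moore–Penrose pseudoinverse of a Hermitian matrix (junk value `0` otherwise). -/
noncomputable def pinvH {m : Type*} [Fintype m] [DecidableEq m] (A : Matrix m m ℂ) :
    Matrix m m ℂ :=
  if hA : A.IsHermitian then
    (hA.eigenvectorUnitary : Matrix m m ℂ) *
      Matrix.diagonal (fun i => if hA.eigenvalues i = 0 then 0 else ((hA.eigenvalues i : ℂ))⁻¹) *
      star (hA.eigenvectorUnitary : Matrix m m ℂ)
  else 0

/-- The orthogonal projection onto the null space of a Hermitian matrix. -/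
noncomputable def nullProj {m : Type*} [Fintype m] [DecidableEq m] (A : Matrix m m ℂ) :
    Matrix m m ℂ :=
  1 - pinvH A * A

/-- The number of positive eigenvalues (with multiplicity) of a Hermitian matrix. -/
noncomputable def iPos {m : Type*} [Fintype m] [DecidableEq m] (A : Matrix m m ℂ) : ℕ :=
  if hA : A.IsHermitian then Nat.card {i // 0 < hA.eigenvalues i} else 0

/-- The number of negative eigenvalues (with multiplicity) of a Hermitian matrix. -/
noncomputable def iNeg {m : Type*} [Fintype m] [DecidableEq m] (A : Matrix m m ℂ) : ℕ :=
  if hA : A.IsHermitian then Nat.card {i // hA.eigenvalues i < 0} else 0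

/-- The number of zero eigenvalues (with multiplicity) of a Hermitian matrix. -/
noncomputable def iZero {m : Type*} [Fintype m] [DecidableEq m] (A : Matrix m m ℂ) : ℕ :=
  if hA : A.IsHermitian then Nat.card {i // hA.eigenvalues i = 0} else 0

/-- The pseudoinverse of a real diagonal matrix inverts its nonzero entries. -/
theorem pinvH_diagonal {m : Type*} [Fintype m] [DecidableEq m] (d : m → ℝ) :
    pinvH (Matrix.diagonal fun i => (d i : ℂ)) = Matrix.diagonal fun i => ((d i)⁻¹ : ℂ) := by
  have hA : (Matrix.diagonal fun i => (d i : ℂ)).IsHermitian := by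
    rw [Matrix.isHermitian_diagonal_iff]
    intro i
    simp [isSelfAdjoint_iff]
  rw [pinvH, dif_pos hA]
  set U := hA.eigenvectorUnitary
  have hDU : Matrix.diagonal (fun i => (d i : ℂ)) * (U : Matrix m m ℂ) =
      U * Matrix.diagonal (fun i => (hA.eigenvalues i : ℂ)) := by
    ext i j
    have key := congrFun (hA.mulVec_eigenvectorBasis j) i
    rw [Matrix.mulVec_diagonal] at key
    rw [Matrix.diagonal_mul, Matrix.mul_diagonal, mul_comm (U.1 i j)]
    simpa [U, Matrix.IsHermitian.eigenvectorUnitary_apply] using key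
  have hinv : (U : Matrix m m ℂ) * Matrix.diagonal (fun i =>
      if hA.eigenvalues i = 0 then 0 else ((hA.eigenvalues i : ℂ))⁻¹) =
      Matrix.diagonal (fun i => ((d i)⁻¹ : ℂ)) * U := by
    ext i j
    have key := congrFun (congrFun hDU i) j
    rw [Matrix.diagonal_mul, Matrix.mul_diagonal, mul_comm] at key
    rw [Matrix.diagonal_mul, Matrix.mul_diagonal, mul_comm (_⁻¹)]
    by_cases hU : (U : Matrix m m ℂ) i j = 0
    · simp [hU]
    · have hd : d i = hA.eigenvalues j := by exact_mod_cast mul_left_cancel₀ hU key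
      rw [hd]
      split_ifs with h0 <;> simp [h0]
  rw [hinv, Matrix.mul_assoc, Unitary.mul_star_self_of_mem U.2, Matrix.mul_one]

theorem nullProj_diagonal {m : Type*} [Fintype m] [DecidableEq m] (d : m → ℝ) :
    nullProj (Matrix.diagonal fun i => (d i : ℂ)) =
      Matrix.diagonal fun i => if d i = 0 then 1 else 0 := by
  rw [nullProj, pinvH_diagonal, Matrix.diagonal_mul_diagonal, ← Matrix.diagonal_one,
    Matrix.diagonal_sub]
  congr 1
  ext i
  by_cases h : d i = 0 <;> simp [h]

/-- The off-diagonal entries of an edge term are cancelled by its rank-one correction. -/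
theorem edge_term_im_eq_zero {ι : Type*} [DecidableEq ι] (u v i k : ι) (a x y : ℂ) (r : ℝ)
    (hr : r ≠ 0) (hax : a * x * starRingEnd ℂ y = -r) :
    ((if u = i ∧ v = k then a else 0) + (if v = i ∧ u = k then starRingEnd ℂ a else 0) -
      I * (a * x * (if i = u then 1 else 0) - starRingEnd ℂ a * y * (if i = v then 1 else 0)) *
        (r : ℂ)⁻¹ *
      starRingEnd ℂ (I * (a * x * (if k = u then 1 else 0) -
        starRingEnd ℂ a * y * (if k = v then 1 else 0)))).im = 0 := by
  have hrc : (r : ℂ) ≠ 0 := by exact_mod_cast hr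
  by_cases hik : i = k
  · subst hik
    set z := I * (a * x * (if i = u then 1 else 0) -
      starRingEnd ℂ a * y * (if i = v then 1 else 0))
    have hz : (z * (r : ℂ)⁻¹ * starRingEnd ℂ z).im = 0 := by
      rw [mul_right_comm, Complex.mul_conj, ← Complex.ofReal_inv, ← Complex.ofReal_mul,
        Complex.ofReal_im]
    rw [Complex.sub_im, hz]
    by_cases h1 : u = i <;> by_cases h2 : v = i <;> simp [h1, h2]
  · have hax' : starRingEnd ℂ a * starRingEnd ℂ x * y = -r := by
      simpa using congrArg (starRingEnd ℂ) hax
    by_cases h1 : i = u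
    · subst h1
      by_cases h2 : k = v
      · subst h2
        have : a - I * (a * x) * (r : ℂ)⁻¹ *
            starRingEnd ℂ (I * -(starRingEnd ℂ a * y)) = 0 := by
          simp only [map_mul, map_neg, Complex.conj_I, Complex.conj_conj]
          field_simp
          linear_combination a * hax - a * (a * x * starRingEnd ℂ y) * Complex.I_sq
        simpa [hik, Ne.symm hik] using congrArg Complex.im this
      · simp [hik, h2, Ne.symm hik, Ne.symm h2]
    · by_cases h2 : i = v
      · subst h2
        by_cases h3 : k = u
        · subst h3
          have : starRingEnd ℂ a - I * -(starRingEnd ℂ a * y) * (r : ℂ)⁻¹ *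
              starRingEnd ℂ (I * (a * x)) = 0 := by
            simp only [map_mul, Complex.conj_I]
            field_simp
            linear_combination starRingEnd ℂ a * hax' -
              starRingEnd ℂ a * (starRingEnd ℂ a * starRingEnd ℂ x * y) * Complex.I_sq
          simpa [hik, Ne.symm hik] using congrArg Complex.im this
        · simp [hik, h3, Ne.symm hik, Ne.symm h3, Ne.symm h1]
      · simp [h1, h2, Ne.symm h1, Ne.symm h2]

/-- Lemma 4.5 of the paper: in the time-reversal symmetric case, at a critical point
with simple eigenvalue and eigenvector non-vanishing on crossing edges, the compressed
operator `S = Q(T(α°) − λ(α°) − BΩ⁺B*)Q*` has real entries. -/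
theorem compressed_operator_S_is_real
    (d N : ℕ) (hd : 0 < d) (hN : 0 < N)
    (u v : Fin d → Fin N) (h : Fin d → ℂ) (hh : ∀ j, h j ≠ 0)
    (T0 : Matrix (Fin N) (Fin N) ℂ) (hT0 : T0.IsHermitian)
    (T : (Fin d → ℝ) → Matrix (Fin N) (Fin N) ℂ)
    (hT : ∀ α : Fin d → ℝ, T α = T0 + ∑ j : Fin d,
      (Matrix.single (u j) (v j) (h j * Complex.exp (Complex.I * (α j : ℂ))) +
       Matrix.single (v j) (u j)
         ((starRingEnd ℂ) (h j) * Complex.exp (-(Complex.I * (α j : ℂ))))))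
    (n : Fin N)
    (hT0real : ∀ i j, (T0 i j).im = 0) (hhreal : ∀ j, (h j).im = 0)
    (α0 : Fin d → ℝ) (f : Fin N → ℂ)
    (hsimple : Nat.card {i : Fin N // sortedEigs (T α0) i = sortedEigs (T α0) n} = 1)
    (hunit : star f ⬝ᵥ f = (1 : ℂ))
    (heig : (T α0).mulVec f = ((sortedEigs (T α0) n : ℝ) : ℂ) • f)
    (hcrit : ∀ j, (h j * Complex.exp (Complex.I * (α0 j : ℂ)) * f (v j) *
      (starRingEnd ℂ) (f (u j))).im = 0)
    (hnv : ∀ j, f (u j) ≠ 0 ∨ f (v j) ≠ 0)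
    (B : Matrix (Fin N) (Fin d) ℂ)
    (hB : B = Matrix.of fun i j => Complex.I *
      (h j * Complex.exp (Complex.I * (α0 j : ℂ)) * f (v j) * (if i = u j then 1 else 0) -
       (starRingEnd ℂ) (h j) * Complex.exp (-(Complex.I * (α0 j : ℂ))) * f (u j) *
         (if i = v j then 1 else 0)))
    (Ω : Matrix (Fin d) (Fin d) ℂ)
    (hΩ : Ω = Matrix.diagonal fun j =>
      (((-(h j * Complex.exp (Complex.I * (α0 j : ℂ)) * f (v j) *
        (starRingEnd ℂ) (f (u j)))).re : ℝ) : ℂ))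
    (P : Matrix (Fin d) (Fin d) ℂ) (hP : P = nullProj Ω)
    (Q : Matrix (Fin N) (Fin N) ℂ) (hQ : Q = nullProj (B * P * Bᴴ))
    (M : Matrix (Fin N) (Fin N) ℂ)
    (hM : M = T α0 - ((sortedEigs (T α0) n : ℝ) : ℂ) • (1 : Matrix (Fin N) (Fin N) ℂ) -
      B * pinvH Ω * Bᴴ) :
    ∀ i j : Fin N, ((Q * M * Qᴴ) i j).im = 0 := by
  obtain ⟨a, ha⟩ : ∃ a : Fin d → ℂ, ∀ j, h j * Complex.exp (Complex.I * (α0 j : ℂ)) = a j :=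
    ⟨_, fun _ => rfl⟩
  have ha' : ∀ j, starRingEnd ℂ (h j) * Complex.exp (-(Complex.I * (α0 j : ℂ))) =
      starRingEnd ℂ (a j) := by
    intro j
    rw [← ha, map_mul, ← Complex.exp_conj]
    simp
  have ha0 : ∀ j, a j ≠ 0 := fun j => by
    rw [← ha]
    exact mul_ne_zero (hh j) (Complex.exp_ne_zero _)
  simp only [ha, ha'] at hcrit hB hΩ
  obtain ⟨r, hr⟩ : ∃ r : Fin d → ℝ, ∀ j,
      (-(a j * f (v j) * starRingEnd ℂ (f (u j)))).re = r j := ⟨_, fun _ => rfl⟩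
  simp only [hr] at hΩ
  have har : ∀ j, a j * f (v j) * starRingEnd ℂ (f (u j)) = -(r j : ℂ) := by
    intro j
    rw [← hr]
    apply Complex.ext
    · simp
    · simpa using hcrit j
  have hBe : ∀ i j, B i j = I * (a j * f (v j) * (if i = u j then 1 else 0) -
      starRingEnd ℂ (a j) * f (u j) * (if i = v j then 1 else 0)) := by
    intro i j
    rw [hB, Matrix.of_apply]
  have hzero : ∀ j, r j = 0 → f (u j) = 0 ∨ f (v j) = 0 := by
    intro j hj
    have := har j
    simp only [hj, Complex.ofReal_zero, neg_zero, mul_eq_zero, ha0 j, false_or,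
      map_eq_zero] at this
    exact this.symm
  have huv : ∀ j, r j = 0 → u j ≠ v j := by
    intro j hj he
    have h1 := hzero j hj
    have h2 := hnv j
    rw [he] at h1 h2
    tauto
  rw [hΩ, nullProj_diagonal] at hP
  rw [hΩ, pinvH_diagonal] at hM
  let g : Fin N → ℝ := fun i => ∑ j, if r j = 0 then Complex.normSq (B i j) else 0
  have hBPB : B * P * Bᴴ = Matrix.diagonal fun i => (g i : ℂ) := by
    ext i k
    rw [hP, Matrix.mul_apply, Matrix.diagonal_apply]
    simp only [Matrix.mul_diagonal, Matrix.conjTranspose_apply]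
    split_ifs with hik
    · subst hik
      simp only [g, Complex.ofReal_sum]
      refine Finset.sum_congr rfl fun j _ => ?_
      split_ifs
      · rw [mul_one, ← Complex.mul_conj]
        rfl
      · simp
    · refine Finset.sum_eq_zero fun j _ => ?_
      split_ifs with hj
      · rw [hBe, hBe]
        rcases hzero j hj with hf | hf
        · by_cases h1 : i = u j <;> by_cases h2 : k = u j <;> simp [hf, h1, h2]
          exact (hik (h1.trans h2.symm)).elim
        · by_cases h1 : i = v j <;> by_cases h2 : k = v j <;> simp [hf, h1, h2]
          exact (hik (h1.trans h2.symm)).elim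
      · simp
  rw [hBPB, nullProj_diagonal] at hQ
  have hBvanish : ∀ i, g i = 0 → ∀ j, r j = 0 → B i j = 0 := by
    intro i hi j hj
    have hnonneg : ∀ l ∈ Finset.univ,
        0 ≤ if r l = 0 then Complex.normSq (B i l) else 0 := by
      intro l _
      split_ifs
      exacts [Complex.normSq_nonneg _, le_rfl]
    have := (Finset.sum_eq_zero_iff_of_nonneg hnonneg).1 hi j (Finset.mem_univ j)
    simpa [hj] using this
  have hMreal : ∀ i k, g i = 0 → g k = 0 → (M i k).im = 0 := by
    intro i k hi hk
    have hexpand : M i k = T0 i k -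
        ((sortedEigs (T α0) n : ℝ) : ℂ) * (1 : Matrix (Fin N) (Fin N) ℂ) i k +
        ∑ j, ((if u j = i ∧ v j = k then a j else 0) +
          (if v j = i ∧ u j = k then starRingEnd ℂ (a j) else 0) -
          B i j * (r j : ℂ)⁻¹ * starRingEnd ℂ (B k j)) := by
      have hentry : T α0 i k = T0 i k + ∑ j, ((if u j = i ∧ v j = k then a j else 0) +
          (if v j = i ∧ u j = k then starRingEnd ℂ (a j) else 0)) := by
        rw [hT, Matrix.add_apply, Matrix.sum_apply]
        simp only [ha, ha', Matrix.add_apply, Matrix.single_apply]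
      rw [hM, Matrix.sub_apply, Matrix.sub_apply, hentry, Matrix.smul_apply, Matrix.mul_apply,
        Finset.sum_sub_distrib]
      simp only [Matrix.mul_diagonal, Matrix.conjTranspose_apply, smul_eq_mul, starRingEnd_apply]
      ring
    have hone : (((sortedEigs (T α0) n : ℝ) : ℂ) *
        (1 : Matrix (Fin N) (Fin N) ℂ) i k).im = 0 := by
      by_cases hik : i = k <;> simp [Matrix.one_apply, hik]
    rw [hexpand, Complex.add_im, Complex.sub_im, hT0real, hone, Complex.im_sum, sub_zero, zero_add]
    refine Finset.sum_eq_zero fun j _ => ?_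
    by_cases hj : r j = 0
    · have hcross : ∀ l l', g l = 0 → g l' = 0 → ¬(u j = l ∧ v j = l') := by
        rintro _ _ hl hl' ⟨rfl, rfl⟩
        have h1 := hBvanish _ hl j hj
        have h2 := hBvanish _ hl' j hj
        rw [hBe] at h1 h2
        have hfv : f (v j) = 0 := by simpa [huv j hj, ha0 j] using h1
        have hfu : f (u j) = 0 := by simpa [(huv j hj).symm, ha0 j] using h2
        exact (hnv j).elim (fun h => h hfu) fun h => h hfv
      rw [if_neg (hcross i k hi hk), if_neg fun h => hcross k i hk hi h.symm,
        hBvanish i hi j hj]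
      simp
    · rw [hBe, hBe]
      exact edge_term_im_eq_zero _ _ _ _ _ _ _ _ hj (har j)
  intro i k
  rw [hQ, Matrix.diagonal_conjTranspose, Matrix.mul_diagonal, Matrix.diagonal_mul]
  by_cases hi : g i = 0 <;> by_cases hk : g k = 0 <;> simp [hi, hk]
  exact hMreal i k hi hk
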